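/- Let u : ℝⁿ → ℝ be twice continuously differentiable and polynomially bounded, i.e., |u(x)| ≤ C(1 + |x|)^N for some C > 0 and N ∈ ℕ. If Δu(x) = c·u(x) for all x ∈ ℝⁿ, where c > 0 is a constant, then u ≡ 0. -/

import Mathlib

open MeasureTheory Filter Set

/-- The Laplacian of `f : ℝⁿ → ℝ` at `x`: the sum of the pure second partial
derivatives in the coordinate directions. -/
noncomputable def lap {n : ℕ} (f : EuclideanSpace ℝ (Fin n) → ℝ)
    (x : EuclideanSpace ℝ (Fin n)) : ℝ :=
  ∑ i : Fin n,
    iteratedFDeriv ℝ 2 f x ![EuclideanSpace.single i 1, EuclideanSpace.single i 1]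

open Topology in
/-- At a local maximum, the second derivative of a function on the line is nonpositive. -/
lemma IsLocalMax.second_deriv_nonpos {f f' : ℝ → ℝ} {a d : ℝ} (hmax : IsLocalMax f a)
    (hf : ∀ t, HasDerivAt f (f' t) t) (hf' : HasDerivAt f' d a) : d ≤ 0 := by
  by_contra! hd
  have hderiv : deriv f = f' := funext fun t => (hf t).deriv
  have hmin : IsLocalMin f a := isLocalMin_of_deriv_deriv_pos
    (by rw [hderiv, hf'.deriv]; exact hd) hmax.deriv_eq_zero (hf a).continuousAt
  have hconst : f =ᶠ[𝓝 a] fun _ => f a := by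
    filter_upwards [hmax, hmin] with t h₁ h₂ using le_antisymm h₁ h₂
  have hzero : f' =ᶠ[𝓝 a] fun _ => (0 : ℝ) := by
    rw [← hderiv]
    simpa using hconst.deriv
  have := hf'.unique ((hasDerivAt_const a (0 : ℝ)).congr_of_eventuallyEq hzero)
  exact hd.ne' this

section Line

variable {E : Type*} [NormedAddCommGroup E] [NormedSpace ℝ E] {u : E → ℝ}

lemma hasDerivAt_comp_line (hu : ContDiff ℝ 2 u) (x e : E) (t : ℝ) :
    HasDerivAt (fun s : ℝ => u (x + s • e)) (fderiv ℝ u (x + t • e) e) t := by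
  have hline : HasDerivAt (fun s : ℝ => x + s • e) e t := by
    simpa using ((hasDerivAt_id t).smul_const e).const_add x
  exact ((hu.differentiable (by norm_num)) _).hasFDerivAt.comp_hasDerivAt t hline

lemma hasDerivAt_fderiv_comp_line (hu : ContDiff ℝ 2 u) (x e : E) :
    HasDerivAt (fun s : ℝ => fderiv ℝ u (x + s • e) e) (iteratedFDeriv ℝ 2 u x ![e, e]) 0 := by
  have hline : HasDerivAt (fun s : ℝ => x + s • e) e 0 := by
    simpa using ((hasDerivAt_id (0 : ℝ)).smul_const e).const_add x
  have hdiff : Differentiable ℝ (fderiv ℝ u) :=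
    (hu.fderiv_right (m := 1) (by norm_num)).differentiable (by norm_num)
  have h : HasDerivAt (fun s : ℝ => fderiv ℝ u (x + s • e))
      (fderiv ℝ (fderiv ℝ u) (x + (0 : ℝ) • e) e) 0 :=
    (hdiff _).hasFDerivAt.comp_hasDerivAt (0 : ℝ) hline
  simpa [iteratedFDeriv_two_apply] using h.clm_apply (hasDerivAt_const (0 : ℝ) e)

end Line

/-- The barrier `∑ i, cosh (a * x i)`, an eigenfunction of the Laplacian with eigenvalue `a ^ 2`. -/
noncomputable def coshSum {n : ℕ} (a : ℝ) (x : EuclideanSpace ℝ (Fin n)) : ℝ :=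
  ∑ i : Fin n, Real.cosh (a * x i)

lemma continuous_coshSum {n : ℕ} (a : ℝ) :
    Continuous (coshSum a : EuclideanSpace ℝ (Fin n) → ℝ) := by
  unfold coshSum
  fun_prop

lemma coshSum_add_single {n : ℕ} (a : ℝ) (x : EuclideanSpace ℝ (Fin n)) (i : Fin n) (t : ℝ) :
    coshSum a (x + t • EuclideanSpace.single i 1) =
      Real.cosh (a * (x i + t)) + ∑ j ∈ Finset.univ.erase i, Real.cosh (a * x j) := by
  unfold coshSum
  rw [← Finset.add_sum_erase _ _ (Finset.mem_univ i)]
  congr 1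
  · simp
  · refine Finset.sum_congr rfl fun j hj => ?_
    simp [Finset.ne_of_mem_erase hj]

lemma exp_norm_le_coshSum {n : ℕ} [NeZero n] {a : ℝ} (ha : 0 ≤ a)
    (x : EuclideanSpace ℝ (Fin n)) : Real.exp (a / n * ‖x‖) / 2 ≤ coshSum a x := by
  have hn : (0 : ℝ) < n := by exact_mod_cast Nat.pos_of_neZero n
  obtain ⟨i, -, hi⟩ := Finset.exists_max_image Finset.univ (fun i => |x i|) ⟨0, Finset.mem_univ _⟩
  have hnorm : ‖x‖ ≤ n * |x i| := by
    calc ‖x‖ = ‖∑ j, EuclideanSpace.single j (x j)‖ := by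
          congr 1
          ext k
          simp [Finset.sum_apply, Pi.single_apply]
      _ ≤ ∑ j, |x j| := (norm_sum_le _ _).trans (by simp)
      _ ≤ ∑ _j : Fin n, |x i| := Finset.sum_le_sum hi
      _ = n * |x i| := by simp
  have harg : a / n * ‖x‖ ≤ |a * x i| := by
    rw [abs_mul, abs_of_nonneg ha, div_mul_eq_mul_div, div_le_iff₀ hn]
    nlinarith [mul_le_mul_of_nonneg_left hnorm ha]
  calc Real.exp (a / n * ‖x‖) / 2 ≤ Real.exp |a * x i| / 2 := by gcongr
    _ ≤ Real.cosh |a * x i| := by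
      rw [Real.cosh_eq]
      gcongr
      linarith [Real.exp_pos (-|a * x i|)]
    _ = Real.cosh (a * x i) := Real.cosh_abs _
    _ ≤ coshSum a x := Finset.single_le_sum (f := fun j => Real.cosh (a * x j))
      (fun j _ => (Real.cosh_pos _).le) (Finset.mem_univ i)

lemma tendsto_const_mul_one_add_pow_sub_exp (C : ℝ) (N : ℕ) {b δ : ℝ} (hb : 0 < b)
    (hδ : 0 < δ) :
    Tendsto (fun r : ℝ => C * (1 + r) ^ N - δ * Real.exp (b * r)) atTop atBot := by
  have hexp : Tendsto (fun r : ℝ => Real.exp (b * r)) atTop atTop :=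
    Real.tendsto_exp_atTop.comp (tendsto_id.const_mul_atTop hb)
  have hratio : Tendsto (fun r : ℝ => C * ((1 + r) ^ N * Real.exp (-(b * r))) - δ)
      atTop (nhds (-δ)) := by
    have h := (Real.tendsto_pow_mul_exp_neg_atTop_nhds_zero N).comp
      ((tendsto_atTop_add_const_left atTop (1 : ℝ) tendsto_id).const_mul_atTop hb)
    have h' := ((h.const_mul (C * (Real.exp b / b ^ N))).sub_const δ)
    simp only [mul_zero, zero_sub] at h'
    refine h'.congr fun r => ?_
    simp only [Function.comp_apply, id]
    rw [show -(b * (1 + r)) = -b + -(b * r) by ring, Real.exp_add, mul_pow, Real.exp_neg b]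
    have := (Real.exp_pos b).ne'
    field_simp
  refine (hexp.atTop_mul_neg (neg_neg_of_pos hδ) hratio).congr fun r => ?_
  rw [Real.exp_neg]
  have := (Real.exp_pos (b * r)).ne'
  field_simp

section Barrier

variable {n : ℕ} {u : EuclideanSpace ℝ (Fin n) → ℝ}

/-- At a maximum of `u - ε * coshSum a`, the Laplacian of `u` is at most that of
`ε * coshSum a`. -/
lemma lap_le_of_isMax_sub_coshSum (hu : ContDiff ℝ 2 u) {a ε : ℝ} {x : EuclideanSpace ℝ (Fin n)}
    (hmax : ∀ y, u y - ε * coshSum a y ≤ u x - ε * coshSum a x) :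
    lap u x ≤ ε * (a ^ 2 * coshSum a x) := by
  unfold lap
  rw [coshSum, Finset.mul_sum, Finset.mul_sum]
  refine Finset.sum_le_sum fun i _ => ?_
  set e : EuclideanSpace ℝ (Fin n) := EuclideanSpace.single i 1
  have harg : ∀ t : ℝ, HasDerivAt (fun s : ℝ => a * (x i + s)) a t := fun t => by
    simpa using ((hasDerivAt_id t).const_add (x i)).const_mul a
  have hfirst : ∀ t : ℝ, HasDerivAt (fun s : ℝ => u (x + s • e) - ε * coshSum a (x + s • e))
      (fderiv ℝ u (x + t • e) e - ε * (Real.sinh (a * (x i + t)) * a)) t := fun t => by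
    simp only [e, coshSum_add_single]
    exact (hasDerivAt_comp_line hu x _ t).sub (((harg t).cosh.add_const _).const_mul ε)
  have hsecond : HasDerivAt
      (fun t : ℝ => fderiv ℝ u (x + t • e) e - ε * (Real.sinh (a * (x i + t)) * a))
      (iteratedFDeriv ℝ 2 u x ![e, e] - ε * (Real.cosh (a * (x i + 0)) * a * a)) 0 :=
    (hasDerivAt_fderiv_comp_line hu x e).sub (((harg 0).sinh.mul_const a).const_mul ε)
  have hloc : IsLocalMax (fun s : ℝ => u (x + s • e) - ε * coshSum a (x + s • e)) 0 :=
    Eventually.of_forall fun s => by simpa using hmax (x + s • e)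
  have h := hloc.second_deriv_nonpos hfirst hsecond
  rw [add_zero] at h
  linarith

lemma nonpos_of_lap_eq_mul (hu : ContDiff ℝ 2 u) {c C : ℝ} {N : ℕ}
    (hbound : ∀ x, u x ≤ C * (1 + ‖x‖) ^ N) (hc : 0 < c) (heq : ∀ x, lap u x = c * u x)
    (x : EuclideanSpace ℝ (Fin n)) : u x ≤ 0 := by
  rcases Nat.eq_zero_or_pos n with rfl | hn
  · have h := heq x
    simp only [lap, Finset.univ_eq_empty, Finset.sum_empty] at h
    nlinarith
  have : NeZero n := ⟨hn.ne'⟩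
  have ha : 0 < √c := Real.sqrt_pos.mpr hc
  have key : ∀ ε > 0, u x ≤ ε * coshSum √c x := by
    intro ε hε
    have hlim : Tendsto (fun y => u y - ε * coshSum √c y)
        (cocompact (EuclideanSpace ℝ (Fin n))) atBot := by
      refine tendsto_atBot_mono (fun y => ?_)
        ((tendsto_const_mul_one_add_pow_sub_exp C N
          (div_pos ha (Nat.cast_pos.mpr hn : (0 : ℝ) < n)) (half_pos hε)).comp
          (tendsto_norm_cocompact_atTop (E := EuclideanSpace ℝ (Fin n))))
      have h := mul_le_mul_of_nonneg_left (exp_norm_le_coshSum ha.le y) hε.le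
      simp only [Function.comp_apply]
      linarith [hbound y]
    obtain ⟨z, hz⟩ := (hu.continuous.sub
      (continuous_const.mul (continuous_coshSum √c))).exists_forall_ge hlim
    have h := lap_le_of_isMax_sub_coshSum hu hz
    rw [heq, Real.sq_sqrt hc.le] at h
    have hle : u z ≤ ε * coshSum √c z := le_of_mul_le_mul_left (by linarith) hc
    have hx : u x - ε * coshSum √c x ≤ u z - ε * coshSum √c z := hz x
    linarith
  have hlim : Tendsto (fun ε : ℝ => ε * coshSum √c x) (nhdsWithin 0 (Ioi 0)) (nhds 0) := by
    have h : Tendsto (fun ε : ℝ => ε * coshSum √c x) (nhds 0) (nhds (0 * coshSum √c x)) :=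
      tendsto_id.mul_const _
    rw [zero_mul] at h
    exact h.mono_left nhdsWithin_le_nhds
  exact ge_of_tendsto hlim (eventually_nhdsWithin_of_forall key)

end Barrier

lemma lap_neg {n : ℕ} (u : EuclideanSpace ℝ (Fin n) → ℝ) (x : EuclideanSpace ℝ (Fin n)) :
    lap (-u) x = -lap u x := by
  simp [lap, iteratedFDeriv_neg_apply]

/-- A twice continuously differentiable, polynomially bounded
function `u : ℝⁿ → ℝ` satisfying `Δu = c u` with a constant `c > 0` vanishes
identically. (This is the consequence of Shnol's theorem used in the uniqueness
theorem: `-Δ` on `L²(ℝⁿ)` has spectrum `[0,∞)`, so there is no nonzero polynomially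
bounded generalized eigenfunction with negative eigenvalue `-c`.) -/
theorem statement11
    (n : ℕ) (u : EuclideanSpace ℝ (Fin n) → ℝ) (c C : ℝ) (N : ℕ)
    (hu : ContDiff ℝ 2 u)
    (hC : 0 < C)
    (hbound : ∀ x, |u x| ≤ C * (1 + ‖x‖) ^ N)
    (hc : 0 < c)
    (heq : ∀ x, lap u x = c * u x) :
    ∀ x, u x = 0 := by
  intro x
  refine le_antisymm
    (nonpos_of_lap_eq_mul hu (fun y => (le_abs_self _).trans (hbound y)) hc heq x) ?_
  have h := nonpos_of_lap_eq_mul (u := -u) hu.neg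
    (fun y => (neg_le_abs _).trans (hbound y)) hc (fun y => by simp [lap_neg, heq]) x
  simpa using h
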